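/- For any density operator ρ_{AB}, the total uncertainty of the bipartite guessing game satisfies S(R|AB)_κ + S(A|B)_ω ≥ S(R)_κ + D(κ_A ‖ ω_A) + S(A|B)_ρ. -/

import Mathlib

open scoped Kronecker Classical ComplexOrder
open Matrix

noncomputable section

/-- The rank-one projector `|v⟩⟨v|`. -/
def proj {α : Type*} (v : α → ℂ) : Matrix α α ℂ := Matrix.vecMulVec v (star v)

/-- Matrix logarithm of a Hermitian matrix, via the spectral decomposition
(junk value `0` on non-Hermitian matrices; eigenvalue `0` contributes `log 0 = 0`). -/
def mlog {n : Type*} [Fintype n] [DecidableEq n] (ρ : Matrix n n ℂ) : Matrix n n ℂ :=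
  if h : ρ.IsHermitian then
    (h.eigenvectorUnitary : Matrix n n ℂ) *
      Matrix.diagonal (fun i => (Real.log (h.eigenvalues i) : ℂ)) *
      (h.eigenvectorUnitary : Matrix n n ℂ)ᴴ
  else 0

/-- Von Neumann entropy `S(ρ) = -Tr ρ log ρ`. -/
def vN {n : Type*} [Fintype n] [DecidableEq n] (ρ : Matrix n n ℂ) : ℝ :=
  -(Matrix.trace (ρ * mlog ρ)).re

/-- Quantum relative entropy `D(ρ‖σ) = Tr ρ (log ρ - log σ)`. -/
def relent {n : Type*} [Fintype n] [DecidableEq n] (ρ σ : Matrix n n ℂ) : ℝ :=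
  (Matrix.trace (ρ * (mlog ρ - mlog σ))).re

/-- The rotation `e^{-iGr}` generated by the Hermitian operator `G` with orthonormal
eigenbasis `g` and eigenvalues `gv`. -/
def Urot {iA : Type*} [Fintype iA] (g : iA → iA → ℂ) (gv : iA → ℝ) (r : ℝ) : Matrix iA iA ℂ :=
  ∑ l, Complex.exp (-(Complex.I) * (gv l) * r) • proj (g l)

section Bipartite

variable {iR iA iB : Type*} [Fintype iR] [Fintype iA] [Fintype iB]
  [DecidableEq iR] [DecidableEq iA] [DecidableEq iB]

/-- `κ_{RAB} = Σ_k p_k |r_k⟩⟨r_k| ⊗ (e^{-iGr_k}⊗I) ρ (e^{iGr_k}⊗I)`. -/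
def kappa2 (p : iR → ℝ) (rb : iR → iR → ℂ) (rv : iR → ℝ) (g : iA → iA → ℂ) (gv : iA → ℝ)
    (ρ : Matrix (iA × iB) (iA × iB) ℂ) :
    Matrix (iR × (iA × iB)) (iR × (iA × iB)) ℂ :=
  ∑ k, (p k : ℂ) •
    (proj (rb k) ⊗ₖ
      ((Urot g gv (rv k) ⊗ₖ (1 : Matrix iB iB ℂ)) * ρ *
        (Urot g gv (rv k) ⊗ₖ (1 : Matrix iB iB ℂ))ᴴ))

/-- `ω_{AB} = Σ_l (|g_l⟩⟨g_l|⊗I) ρ (|g_l⟩⟨g_l|⊗I)`. -/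
def omega2 (g : iA → iA → ℂ) (ρ : Matrix (iA × iB) (iA × iB) ℂ) :
    Matrix (iA × iB) (iA × iB) ℂ :=
  ∑ l, ((proj (g l) ⊗ₖ (1 : Matrix iB iB ℂ)) * ρ * (proj (g l) ⊗ₖ (1 : Matrix iB iB ℂ)))

/-- Reduced state on `AB` of a state on `RAB`. -/
def redABthree (τ : Matrix (iR × (iA × iB)) (iR × (iA × iB)) ℂ) :
    Matrix (iA × iB) (iA × iB) ℂ :=
  Matrix.of fun x y => ∑ k : iR, τ (k, x) (k, y)

/-- Reduced state on `R` of a state on `RAB`. -/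
def redRthree (τ : Matrix (iR × (iA × iB)) (iR × (iA × iB)) ℂ) :
    Matrix iR iR ℂ :=
  Matrix.of fun i j => ∑ x : iA × iB, τ (i, x) (j, x)

/-- Reduced state on `A` of a state on `RAB`. -/
def redAthree (τ : Matrix (iR × (iA × iB)) (iR × (iA × iB)) ℂ) :
    Matrix iA iA ℂ :=
  Matrix.of fun i j => ∑ k : iR, ∑ b : iB, τ (k, (i, b)) (k, (j, b))

/-- Reduced state on `A` of a state on `AB`. -/
def redA2 (σ : Matrix (iA × iB) (iA × iB) ℂ) : Matrix iA iA ℂ :=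
  Matrix.of fun i j => ∑ b : iB, σ (i, b) (j, b)

/-- Reduced state on `B` of a state on `AB`. -/
def redB2' (σ : Matrix (iA × iB) (iA × iB) ℂ) : Matrix iB iB ℂ :=
  Matrix.of fun i j => ∑ a : iA, σ (a, i) (a, j)

end Bipartite

lemma unit_comm {n : Type*} [Fintype n] [DecidableEq n] {V : Matrix n n ℂ} (hV : V * Vᴴ = 1) :
    Vᴴ * V = 1 := mul_eq_one_comm.mp hV

lemma mlog_of_diag {n : Type*} [Fintype n] [DecidableEq n] {V M : Matrix n n ℂ}
    (hV : V * Vᴴ = 1) (d : n → ℝ)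
    (hM : M = V * diagonal (fun i => (d i : ℂ)) * Vᴴ) :
    mlog M = V * diagonal (fun i => (Real.log (d i) : ℂ)) * Vᴴ := by
  have hV' := unit_comm hV
  have hH : M.IsHermitian := by
    subst hM
    unfold Matrix.IsHermitian
    rw [conjTranspose_mul, conjTranspose_mul, diagonal_conjTranspose, conjTranspose_conjTranspose,
      Matrix.mul_assoc]
    congr 3
    ext i
    simp
  have hspec := hH.spectral_theorem
  unfold mlog
  rw [dif_pos hH]
  set U : Matrix n n ℂ := (hH.eigenvectorUnitary : Matrix n n ℂ) with hU
  have hUU : Uᴴ * U = 1 := by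
    have := hH.eigenvectorUnitary.2
    rw [Matrix.mem_unitaryGroup_iff'] at this
    exact this
  have hUU' : U * Uᴴ = 1 := mul_eq_one_comm.mp hUU
  have hs : M = U * diagonal (fun i => (hH.eigenvalues i : ℂ)) * Uᴴ := by
    conv_lhs => rw [hspec]
    rw [Unitary.conjStarAlgAut_apply]
    rfl
  have key : ∀ i j, (Uᴴ * V) i j * d j = hH.eigenvalues i * (Uᴴ * V) i j := by
    intro i j
    have h1 : (Uᴴ * V) * diagonal (fun i => (d i : ℂ)) =
        diagonal (fun i => (hH.eigenvalues i : ℂ)) * (Uᴴ * V) := by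
      have e1 : Uᴴ * M * V = (Uᴴ * V) * diagonal (fun i => (d i : ℂ)) := by
        rw [hM]
        calc _ = (Uᴴ * V) * diagonal (fun i => (d i : ℂ)) * (Vᴴ * V) := by
              simp only [Matrix.mul_assoc]
          _ = _ := by rw [hV', Matrix.mul_one]
      have e2 : Uᴴ * M * V = diagonal (fun i => (hH.eigenvalues i : ℂ)) * (Uᴴ * V) := by
        conv_lhs => rw [hs]
        calc _ = (Uᴴ * U) * diagonal (fun i => (hH.eigenvalues i : ℂ)) * (Uᴴ * V) := by
              simp only [Matrix.mul_assoc]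
          _ = _ := by rw [hUU, Matrix.one_mul]
      rw [← e1, e2]
    have := congrFun (congrFun h1 i) j
    simpa [mul_diagonal, diagonal_mul] using this
  have key2 : diagonal (fun i => (Real.log (hH.eigenvalues i) : ℂ)) * (Uᴴ * V) =
      (Uᴴ * V) * diagonal (fun i => (Real.log (d i) : ℂ)) := by
    ext i j
    rw [mul_diagonal, diagonal_mul]
    by_cases h0 : (Uᴴ * V) i j = 0
    · simp [h0]
    · have := key i j
      rw [mul_comm] at this
      have h2 := mul_right_cancel₀ h0 this
      have h3 : d j = hH.eigenvalues i := by exact_mod_cast h2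
      rw [h3, mul_comm]
  calc U * diagonal (fun i => (Real.log (hH.eigenvalues i) : ℂ)) * Uᴴ
      = U * (diagonal (fun i => (Real.log (hH.eigenvalues i) : ℂ)) * (Uᴴ * V)) * Vᴴ := by
        simp only [Matrix.mul_assoc]; rw [hV, Matrix.mul_one]
    _ = (U * Uᴴ) * V * diagonal (fun i => (Real.log (d i) : ℂ)) * Vᴴ := by
        rw [key2]; simp only [Matrix.mul_assoc]
    _ = _ := by rw [hUU', Matrix.one_mul]

lemma exists_diag {n : Type*} [Fintype n] [DecidableEq n] {M : Matrix n n ℂ}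
    (hM : M.PosSemidef) : ∃ (U : Matrix n n ℂ) (d : n → ℝ), U * Uᴴ = 1 ∧ (∀ i, 0 ≤ d i) ∧
      M = U * diagonal (fun i => (d i : ℂ)) * Uᴴ := by
  have hH := hM.1
  refine ⟨hH.eigenvectorUnitary, hH.eigenvalues, ?_, hM.eigenvalues_nonneg, ?_⟩
  · exact Matrix.mem_unitaryGroup_iff.mp hH.eigenvectorUnitary.2
  · conv_lhs => rw [hH.spectral_theorem]
    rw [Unitary.conjStarAlgAut_apply]
    rfl

lemma trace_diag {n : Type*} [Fintype n] [DecidableEq n] (a b : n → ℝ) (Z : Matrix n n ℂ) :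
    (trace (diagonal (fun i => (a i : ℂ)) * Z * diagonal (fun i => (b i : ℂ)) * Zᴴ)).re =
      ∑ i, ∑ j, a i * b j * Complex.normSq (Z i j) := by
  rw [trace, Complex.re_sum]
  refine Finset.sum_congr rfl fun i _ => ?_
  rw [diag_apply, mul_apply, Complex.re_sum]
  refine Finset.sum_congr rfl fun j _ => ?_
  rw [mul_diagonal, diagonal_mul, conjTranspose_apply]
  have : (a i : ℂ) * Z i j * (b j : ℂ) * star (Z i j) =
      ((a i * b j * Complex.normSq (Z i j) : ℝ) : ℂ) := by
    push_cast
    rw [Complex.normSq_eq_conj_mul_self]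
    simp only [Complex.star_def]
    ring
  rw [this, Complex.ofReal_re]

lemma normSq_row {n : Type*} [Fintype n] [DecidableEq n] {Z : Matrix n n ℂ}
    (hZ : Z * Zᴴ = 1) (i : n) : ∑ j, Complex.normSq (Z i j) = 1 := by
  have := congrFun (congrFun hZ i) i
  rw [mul_apply, one_apply_eq] at this
  have h2 := congrArg Complex.re this
  rw [Complex.re_sum, Complex.one_re] at h2
  rw [← h2]
  refine Finset.sum_congr rfl fun j _ => ?_
  rw [conjTranspose_apply, Complex.star_def, Complex.mul_conj, Complex.ofReal_re]

lemma tr_conj {n : Type*} [Fintype n] [DecidableEq n] {V : Matrix n n ℂ} (hV : V * Vᴴ = 1)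
    (a : n → ℂ) : trace (V * diagonal a * Vᴴ) = ∑ i, a i := by
  rw [trace_mul_comm, ← Matrix.mul_assoc, unit_comm hV, Matrix.one_mul, trace_diagonal]

lemma vN_of_diag {n : Type*} [Fintype n] [DecidableEq n] {V M : Matrix n n ℂ}
    (hV : V * Vᴴ = 1) (d : n → ℝ)
    (hM : M = V * diagonal (fun i => (d i : ℂ)) * Vᴴ) :
    vN M = - ∑ i, d i * Real.log (d i) := by
  unfold vN
  rw [mlog_of_diag hV d hM]
  have : M * (V * diagonal (fun i => (Real.log (d i) : ℂ)) * Vᴴ) =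
      V * diagonal (fun i => ((d i * Real.log (d i) : ℝ) : ℂ)) * Vᴴ := by
    rw [hM]
    calc _ = V * (diagonal (fun i => (d i : ℂ)) * (Vᴴ * V) *
          diagonal (fun i => (Real.log (d i) : ℂ))) * Vᴴ := by simp only [Matrix.mul_assoc]
      _ = _ := by
        rw [unit_comm hV, Matrix.mul_one, diagonal_mul_diagonal]
        push_cast
        rfl
  rw [this, tr_conj hV, Complex.re_sum]
  simp only [Complex.ofReal_re]

lemma relent_eq {n : Type*} [Fintype n] [DecidableEq n] {U W ρ σ : Matrix n n ℂ}
    (hU : U * Uᴴ = 1) (hW : W * Wᴴ = 1) (a b : n → ℝ)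
    (hρ : ρ = U * diagonal (fun i => (a i : ℂ)) * Uᴴ)
    (hσ : σ = W * diagonal (fun i => (b i : ℂ)) * Wᴴ) :
    relent ρ σ = ∑ i, ∑ j, Complex.normSq ((Uᴴ * W) i j) *
      (a i * (Real.log (a i) - Real.log (b j))) := by
  have hU' := unit_comm hU
  have hZ : (Uᴴ * W) * (Uᴴ * W)ᴴ = 1 := by
    rw [conjTranspose_mul, conjTranspose_conjTranspose]
    calc _ = Uᴴ * (W * Wᴴ) * U := by simp only [Matrix.mul_assoc]
      _ = 1 := by rw [hW, Matrix.mul_one, hU']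
  unfold relent
  rw [Matrix.mul_sub, trace_sub, Complex.sub_re]
  have h1 : (trace (ρ * mlog ρ)).re = ∑ i, a i * Real.log (a i) := by
    have := vN_of_diag hU a hρ
    unfold vN at this
    linarith
  have h2 : (trace (ρ * mlog σ)).re =
      ∑ i, ∑ j, a i * Real.log (b j) * Complex.normSq ((Uᴴ * W) i j) := by
    rw [mlog_of_diag hW b hσ, ← trace_diag, hρ]
    congr 1
    calc _ = trace (U * (diagonal (fun i => (a i : ℂ)) * Uᴴ * W *
          diagonal (fun i => (Real.log (b i) : ℂ)) * Wᴴ)) := by simp only [Matrix.mul_assoc]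
      _ = _ := by
        rw [trace_mul_comm, conjTranspose_mul, conjTranspose_conjTranspose]
        simp only [Matrix.mul_assoc]
  rw [h1, h2, ← Finset.sum_sub_distrib]
  refine Finset.sum_congr rfl fun i _ => ?_
  rw [← mul_one (a i * Real.log (a i)), ← normSq_row hZ i, Finset.mul_sum,
    ← Finset.sum_sub_distrib]
  refine Finset.sum_congr rfl fun j _ => ?_
  ring

/-- the quadratic functional of the variational formula -/
def Qf {n : Type*} [Fintype n] (t : ℝ) (ρ σ X : Matrix n n ℂ) : ℝ :=
  2 * (trace (Xᴴ * ρ)).re - (trace (X * σ * Xᴴ)).re - t * (trace (Xᴴ * ρ * X)).re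

lemma Qf_eq {n : Type*} [Fintype n] [DecidableEq n] {U W ρ σ : Matrix n n ℂ}
    (hU : U * Uᴴ = 1) (hW : W * Wᴴ = 1) (a b : n → ℝ)
    (hρ : ρ = U * diagonal (fun i => (a i : ℂ)) * Uᴴ)
    (hσ : σ = W * diagonal (fun i => (b i : ℂ)) * Wᴴ) (t : ℝ) (Y : Matrix n n ℂ) :
    Qf t ρ σ (U * Y * Wᴴ) = ∑ i, ∑ j, (2 * a i * (star (Y i j) * (Uᴴ * W) i j).re -
      (b j + t * a i) * Complex.normSq (Y i j)) := by
  have hU' := unit_comm hU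
  have hW' := unit_comm hW
  have e1 : (trace ((U * Y * Wᴴ)ᴴ * ρ)).re =
      ∑ i, ∑ j, a i * (star (Y i j) * (Uᴴ * W) i j).re := by
    have : trace ((U * Y * Wᴴ)ᴴ * ρ) = trace (Yᴴ * (diagonal (fun i => (a i : ℂ)) * (Uᴴ * W))) := by
      rw [hρ]
      simp only [conjTranspose_mul, conjTranspose_conjTranspose]
      calc _ = trace (W * (Yᴴ * ((Uᴴ * U) * diagonal (fun i => (a i : ℂ)) * Uᴴ))) := by
            simp only [Matrix.mul_assoc]
        _ = _ := by
          rw [hU', Matrix.one_mul, trace_mul_comm]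
          simp only [Matrix.mul_assoc]
    rw [this, trace, Complex.re_sum, Finset.sum_comm]
    refine Finset.sum_congr rfl fun j _ => ?_
    rw [diag_apply, mul_apply, Complex.re_sum]
    refine Finset.sum_congr rfl fun i _ => ?_
    rw [diagonal_mul, conjTranspose_apply, mul_left_comm, Complex.re_ofReal_mul]
  have e2 : (trace ((U * Y * Wᴴ) * σ * (U * Y * Wᴴ)ᴴ)).re =
      ∑ i, ∑ j, b j * Complex.normSq (Y i j) := by
    have := trace_diag (fun _ => 1) b Y
    simp only [one_mul] at this
    rw [← this, hσ]
    congr 1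
    simp only [conjTranspose_mul, conjTranspose_conjTranspose]
    calc _ = trace (U * (Y * (Wᴴ * W) * diagonal (fun i => (b i : ℂ)) * (Wᴴ * W) * Yᴴ * Uᴴ)) := by
          simp only [Matrix.mul_assoc]
      _ = trace (Y * diagonal (fun i => (b i : ℂ)) * Yᴴ * (Uᴴ * U)) := by
          rw [hW', Matrix.mul_one, Matrix.mul_one, trace_mul_comm]
          simp only [Matrix.mul_assoc]
      _ = _ := by
        rw [hU', Matrix.mul_one]
        simp
  have e3 : (trace ((U * Y * Wᴴ)ᴴ * ρ * (U * Y * Wᴴ))).re =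
      ∑ i, ∑ j, a i * Complex.normSq (Y i j) := by
    have := trace_diag a (fun _ => 1) Y
    simp only [mul_one] at this
    rw [← this, hρ]
    congr 1
    simp only [conjTranspose_mul, conjTranspose_conjTranspose]
    calc _ = trace ((W * Yᴴ) * ((Uᴴ * U) * diagonal (fun i => (a i : ℂ)) * (Uᴴ * U) * Y * Wᴴ)) := by
          simp only [Matrix.mul_assoc]
      _ = trace (diagonal (fun i => (a i : ℂ)) * Y * (Wᴴ * W) * Yᴴ) := by
          rw [hU', Matrix.mul_one, Matrix.one_mul, trace_mul_comm]
          simp only [Matrix.mul_assoc]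
      _ = _ := by
        rw [hW', Matrix.mul_one]
        simp
  unfold Qf
  rw [e1, e2, e3]
  simp only [Finset.mul_sum, ← Finset.sum_sub_distrib]
  refine Finset.sum_congr rfl fun i _ => Finset.sum_congr rfl fun j _ => ?_
  ring

/-- resolvent functional in spectral coordinates -/
def Ff {n : Type*} [Fintype n] (a b : n → ℝ) (Z : Matrix n n ℂ) (t : ℝ) : ℝ :=
  ∑ i, ∑ j, Complex.normSq (Z i j) * (a i * (a i / (b j + t * a i)))

lemma Qf_le {n : Type*} [Fintype n] [DecidableEq n] {U W ρ σ : Matrix n n ℂ}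
    (hU : U * Uᴴ = 1) (hW : W * Wᴴ = 1) (a b : n → ℝ)
    (ha : ∀ i, 0 ≤ a i) (hb : ∀ i, 0 ≤ b i)
    (hρ : ρ = U * diagonal (fun i => (a i : ℂ)) * Uᴴ)
    (hσ : σ = W * diagonal (fun i => (b i : ℂ)) * Wᴴ) {t : ℝ} (ht : 0 < t) (X : Matrix n n ℂ) :
    Qf t ρ σ X ≤ Ff a b (Uᴴ * W) t := by
  have hX : X = U * (Uᴴ * X * W) * Wᴴ := by
    calc X = (U * Uᴴ) * X * (W * Wᴴ) := by rw [hU, hW, Matrix.mul_one, Matrix.one_mul]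
      _ = _ := by simp only [Matrix.mul_assoc]
  rw [hX, Qf_eq hU hW a b hρ hσ]
  unfold Ff
  refine Finset.sum_le_sum fun i _ => Finset.sum_le_sum fun j _ => ?_
  generalize (Uᴴ * X * W) i j = y
  generalize (Uᴴ * W) i j = z
  rcases (ha i).eq_or_lt with h0 | h0
  · rw [← h0]
    simp only [mul_zero, zero_mul, add_zero, zero_sub, Left.neg_nonpos_iff]
    exact mul_nonneg (hb j) (Complex.normSq_nonneg y)
  · have hc : 0 < b j + t * a i := by have := hb j; positivity
    set c := b j + t * a i
    have h1 : (star y * z).re = y.re * z.re + y.im * z.im := by simp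
    rw [h1, Complex.normSq_apply, Complex.normSq_apply]
    have h2 : (z.re * z.re + z.im * z.im) * (a i * (a i / c)) -
      (2 * a i * (y.re * z.re + y.im * z.im) - c * (y.re * y.re + y.im * y.im)) =
      ((a i * z.re - c * y.re)^2 + (a i * z.im - c * y.im)^2) / c := by
      field_simp
      ring
    have h3 : 0 ≤ ((a i * z.re - c * y.re)^2 + (a i * z.im - c * y.im)^2) / c := by positivity
    linarith

lemma Qf_attained {n : Type*} [Fintype n] [DecidableEq n] {U W ρ σ : Matrix n n ℂ}
    (hU : U * Uᴴ = 1) (hW : W * Wᴴ = 1) (a b : n → ℝ)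
    (ha : ∀ i, 0 ≤ a i) (hb : ∀ i, 0 ≤ b i)
    (hρ : ρ = U * diagonal (fun i => (a i : ℂ)) * Uᴴ)
    (hσ : σ = W * diagonal (fun i => (b i : ℂ)) * Wᴴ) {t : ℝ} (ht : 0 < t) :
    ∃ X, Qf t ρ σ X = Ff a b (Uᴴ * W) t := by
  refine ⟨U * (Matrix.of fun i j => ((a i / (b j + t * a i) : ℝ) : ℂ) * (Uᴴ * W) i j) * Wᴴ, ?_⟩
  rw [Qf_eq hU hW a b hρ hσ]
  unfold Ff
  refine Finset.sum_congr rfl fun i _ => Finset.sum_congr rfl fun j _ => ?_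
  rw [of_apply]
  generalize (Uᴴ * W) i j = z
  rcases (ha i).eq_or_lt with h0 | h0
  · rw [← h0]
    simp
  · have hc : 0 < b j + t * a i := by have := hb j; positivity
    set c := b j + t * a i
    have h1 : (star (((a i / c : ℝ) : ℂ) * z) * z).re = a i / c * Complex.normSq z := by
      rw [star_mul', Complex.star_def, Complex.conj_ofReal, mul_assoc, Complex.re_ofReal_mul,
        ← Complex.normSq_eq_conj_mul_self, Complex.ofReal_re]
    rw [h1, Complex.normSq_mul, Complex.normSq_ofReal]
    field_simp
    ring

lemma trace_kron_red {iA iB : Type*} [Fintype iA] [Fintype iB] [DecidableEq iB]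
    (M : Matrix iA iA ℂ) (ρ : Matrix (iA × iB) (iA × iB) ℂ) :
    trace ((M ⊗ₖ (1 : Matrix iB iB ℂ)) * ρ) = trace (M * redA2 ρ) := by
  simp only [trace, diag_apply, mul_apply, redA2, of_apply, Fintype.sum_prod_type, kroneckerMap_apply,
    one_apply, mul_ite, mul_one, mul_zero, ite_mul, zero_mul, Finset.sum_ite_eq, Finset.mem_univ,
    if_true, Finset.mul_sum]
  refine Finset.sum_congr rfl fun i _ => ?_
  rw [Finset.sum_comm]

lemma Qf_red {iA iB : Type*} [Fintype iA] [Fintype iB] [DecidableEq iA] [DecidableEq iB] (t : ℝ)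
    (ρ σ : Matrix (iA × iB) (iA × iB) ℂ) (X : Matrix iA iA ℂ) :
    Qf t (redA2 ρ) (redA2 σ) X = Qf t ρ σ (X ⊗ₖ (1 : Matrix iB iB ℂ)) := by
  unfold Qf
  have hX : (X ⊗ₖ (1 : Matrix iB iB ℂ))ᴴ = Xᴴ ⊗ₖ (1 : Matrix iB iB ℂ) := by
    rw [conjTranspose_kronecker, conjTranspose_one]
  rw [hX, trace_kron_red, trace_mul_comm _ (Xᴴ ⊗ₖ (1 : Matrix iB iB ℂ)), ← Matrix.mul_assoc,
    ← mul_kronecker_mul, Matrix.one_mul, trace_kron_red, trace_mul_comm (Xᴴ ⊗ₖ 1 * ρ),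
    ← Matrix.mul_assoc,
    ← mul_kronecker_mul, Matrix.one_mul, trace_kron_red, trace_mul_comm (X * redA2 σ),
    trace_mul_comm (Xᴴ * redA2 ρ), ← Matrix.mul_assoc, ← Matrix.mul_assoc]

/-- integrated resolvent functional -/
def Lf {n : Type*} [Fintype n] (a b : n → ℝ) (Z : Matrix n n ℂ) (t : ℝ) : ℝ :=
  ∑ i, ∑ j, Complex.normSq (Z i j) * (a i * (Real.log (b j + t * a i) - Real.log (b j)))

section Lf
variable {n : Type*} [Fintype n] [DecidableEq n] {a b : n → ℝ} {Z : Matrix n n ℂ}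

lemma Lf_zero : Lf a b Z 0 = 0 := by simp [Lf]

lemma Lf_deriv (ha : ∀ i, 0 ≤ a i) (hb : ∀ i, 0 ≤ b i) {t : ℝ} (ht : 0 < t) :
    HasDerivAt (Lf a b Z) (Ff a b Z t) t := by
  unfold Lf Ff
  refine HasDerivAt.fun_sum fun i _ => HasDerivAt.fun_sum fun j _ => ?_
  refine HasDerivAt.const_mul _ ?_
  rcases (ha i).eq_or_lt with h0 | h0
  · rw [← h0]
    simpa using hasDerivAt_const t (0:ℝ)
  · refine HasDerivAt.const_mul _ (HasDerivAt.sub_const _ ?_)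
    have hc : 0 < b j + t * a i := by have := hb j; positivity
    refine HasDerivAt.log ?_ hc.ne'
    simpa using ((hasDerivAt_id t).mul_const (a i)).const_add (b j)

lemma Lf_cont (ha : ∀ i, 0 ≤ a i) (hb : ∀ i, 0 ≤ b i)
    (hs : ∀ i j, 0 < a i → b j = 0 → Z i j = 0) :
    ContinuousOn (Lf a b Z) (Set.Ici 0) := by
  unfold Lf
  refine continuousOn_finsetSum _ fun i _ => continuousOn_finsetSum _ fun j _ => ?_
  rcases (ha i).eq_or_lt with h0 | h0
  · rw [← h0]; simpa using continuousOn_const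
  · rcases (hb j).eq_or_lt with h1 | h1
    · rw [hs i j h0 h1.symm]; simpa using continuousOn_const
    · refine ContinuousOn.mul continuousOn_const (ContinuousOn.mul continuousOn_const
        (ContinuousOn.sub (ContinuousOn.log (by fun_prop) ?_) continuousOn_const))
      intro t ht
      have ht' : 0 ≤ t := ht
      positivity

lemma Lf_tendsto (ha : ∀ i, 0 ≤ a i) :
    Filter.Tendsto (fun T => Lf a b Z T - (∑ i, ∑ j, Complex.normSq (Z i j) * a i) * Real.log T)
      Filter.atTop (nhds (∑ i, ∑ j, Complex.normSq (Z i j) *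
      (a i * (Real.log (a i) - Real.log (b j))))) := by
  unfold Lf
  simp only [Finset.sum_mul, ← Finset.sum_sub_distrib]
  refine tendsto_finsetSum _ fun i _ => tendsto_finsetSum _ fun j _ => ?_
  rcases (ha i).eq_or_lt with h0 | h0
  · rw [← h0]; simp
  · have h1 : Filter.Tendsto (fun T : ℝ => Real.log (b j / T + a i)) Filter.atTop
        (nhds (Real.log (a i))) := by
      have : Filter.Tendsto (fun T : ℝ => b j / T + a i) Filter.atTop (nhds (0 + a i)) :=
        (Filter.Tendsto.div_atTop tendsto_const_nhds Filter.tendsto_id).add tendsto_const_nhds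
      rw [zero_add] at this
      exact this.log h0.ne'
    have h2 := ((h1.sub_const (Real.log (b j))).const_mul (a i)).const_mul (Complex.normSq (Z i j))
    refine h2.congr' ?_
    have h3 : Filter.Tendsto (fun T : ℝ => b j / T + a i) Filter.atTop (nhds (0 + a i)) :=
        (Filter.Tendsto.div_atTop tendsto_const_nhds Filter.tendsto_id).add tendsto_const_nhds
    rw [zero_add] at h3
    filter_upwards [Filter.eventually_gt_atTop 0, h3.eventually_ne h0.ne'] with T hT hne
    have h4 : b j + T * a i = T * (b j / T + a i) := by field_simp
    rw [h4, Real.log_mul hT.ne' hne]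
    ring

end Lf

lemma supp_coord {n : Type*} [Fintype n] [DecidableEq n] {U W ρ σ : Matrix n n ℂ}
    (hU : U * Uᴴ = 1) (hW : W * Wᴴ = 1) (a b : n → ℝ)
    (hρ : ρ = U * diagonal (fun i => (a i : ℂ)) * Uᴴ)
    (hσ : σ = W * diagonal (fun i => (b i : ℂ)) * Wᴴ)
    (hk : ∀ v, σ *ᵥ v = 0 → ρ *ᵥ v = 0) (i j : n) (hi : 0 < a i) (hj : b j = 0) :
    (Uᴴ * W) i j = 0 := by
  have e1 : σ * W = W * diagonal (fun i => (b i : ℂ)) := by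
    rw [hσ, Matrix.mul_assoc, unit_comm hW, Matrix.mul_one]
  have e2 : Uᴴ * (ρ * W) = diagonal (fun i => (a i : ℂ)) * (Uᴴ * W) := by
    rw [hρ]
    calc _ = (Uᴴ * U) * diagonal (fun i => (a i : ℂ)) * (Uᴴ * W) := by simp only [Matrix.mul_assoc]
      _ = _ := by rw [unit_comm hU, Matrix.one_mul]
  have e3 : σ *ᵥ (fun k => W k j) = 0 := by
    ext x
    have := congrFun (congrFun e1 x) j
    rw [mul_diagonal, hj] at this
    simpa [mul_apply, mulVec, dotProduct] using this
  have e4 := hk _ e3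
  have e5 : ∀ x, (ρ * W) x j = 0 := fun x => congrFun e4 x
  have e6 := congrFun (congrFun e2 i) j
  rw [mul_apply, diagonal_mul] at e6
  simp only [e5, mul_zero, Finset.sum_const_zero] at e6
  have : (a i : ℂ) ≠ 0 := by exact_mod_cast hi.ne'
  exact (mul_eq_zero.mp e6.symm).resolve_left this

lemma weight_sum {n : Type*} [Fintype n] [DecidableEq n] {U W ρ : Matrix n n ℂ}
    (hU : U * Uᴴ = 1) (hW : W * Wᴴ = 1) (a : n → ℝ)
    (hρ : ρ = U * diagonal (fun i => (a i : ℂ)) * Uᴴ) :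
    ∑ i, ∑ j, Complex.normSq ((Uᴴ * W) i j) * a i = (trace ρ).re := by
  have hZ : (Uᴴ * W) * (Uᴴ * W)ᴴ = 1 := by
    rw [conjTranspose_mul, conjTranspose_conjTranspose]
    calc _ = Uᴴ * (W * Wᴴ) * U := by simp only [Matrix.mul_assoc]
      _ = 1 := by rw [hW, Matrix.mul_one, unit_comm hU]
  rw [hρ, tr_conj hU, Complex.re_sum]
  refine Finset.sum_congr rfl fun i _ => ?_
  rw [← Finset.sum_mul, normSq_row hZ, one_mul, Complex.ofReal_re]

theorem relent_mono {iA iB : Type*} [Fintype iA] [Fintype iB] [DecidableEq iA] [DecidableEq iB]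
    {ρ σ : Matrix (iA × iB) (iA × iB) ℂ} (hρ : ρ.PosSemidef) (hσ : σ.PosSemidef)
    (hρA : (redA2 ρ).PosSemidef) (hσA : (redA2 σ).PosSemidef)
    (hk : ∀ v, σ *ᵥ v = 0 → ρ *ᵥ v = 0) (hkA : ∀ v, redA2 σ *ᵥ v = 0 → redA2 ρ *ᵥ v = 0) :
    relent (redA2 ρ) (redA2 σ) ≤ relent ρ σ := by
  obtain ⟨U, a, hU, ha, eρ⟩ := exists_diag hρ
  obtain ⟨W, b, hW, hb, eσ⟩ := exists_diag hσ
  obtain ⟨U', a', hU', ha', eρ'⟩ := exists_diag hρA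
  obtain ⟨W', b', hW', hb', eσ'⟩ := exists_diag hσA
  have hF : ∀ t : ℝ, 0 < t → Ff a' b' (U'ᴴ * W') t ≤ Ff a b (Uᴴ * W) t := by
    intro t ht
    obtain ⟨X, hX⟩ := Qf_attained hU' hW' a' b' ha' hb' eρ' eσ' ht
    rw [← hX, Qf_red]
    exact Qf_le hU hW a b ha hb eρ eσ ht _
  have hL : ∀ T : ℝ, 0 ≤ T → Lf a' b' (U'ᴴ * W') T ≤ Lf a b (Uᴴ * W) T := by
    intro T hT
    have hmono : MonotoneOn (fun T => Lf a b (Uᴴ * W) T - Lf a' b' (U'ᴴ * W') T) (Set.Ici 0) := by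
      refine monotoneOn_of_deriv_nonneg (convex_Ici 0) ?_ ?_ ?_
      · exact (Lf_cont ha hb (supp_coord hU hW a b eρ eσ hk)).sub
          (Lf_cont ha' hb' (supp_coord hU' hW' a' b' eρ' eσ' hkA))
      · intro t ht
        rw [interior_Ici] at ht
        exact ((Lf_deriv ha hb ht).sub (Lf_deriv ha' hb' ht)).differentiableAt.differentiableWithinAt
      · intro t ht
        rw [interior_Ici] at ht
        have := ((Lf_deriv (Z := Uᴴ * W) ha hb ht).sub
          (Lf_deriv (Z := U'ᴴ * W') ha' hb' ht)).deriv
        have h2 := hF t ht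
        have h3 : deriv (fun T => Lf a b (Uᴴ * W) T - Lf a' b' (U'ᴴ * W') T) t =
          Ff a b (Uᴴ * W) t - Ff a' b' (U'ᴴ * W') t := this
        rw [h3]
        linarith
    have := hmono (Set.mem_Ici.mpr le_rfl) (Set.mem_Ici.mpr hT) hT
    simp only [Lf_zero] at this
    linarith
  have htr : (trace (redA2 ρ)) = trace ρ := by
    have := trace_kron_red (1 : Matrix iA iA ℂ) ρ
    rw [one_kronecker_one, Matrix.one_mul, Matrix.one_mul] at this
    exact this.symm
  rw [relent_eq hU hW a b eρ eσ, relent_eq hU' hW' a' b' eρ' eσ']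
  refine le_of_tendsto_of_tendsto (Lf_tendsto ha') (Lf_tendsto ha) ?_
  filter_upwards [Filter.eventually_ge_atTop 0] with T hT
  rw [weight_sum hU hW a eρ, weight_sum hU' hW' a' eρ', htr]
  have := hL T hT
  linarith

section Pinch
variable {n ι : Type*} [Fintype n] [DecidableEq n] [Fintype ι] [DecidableEq ι]

lemma mlog_commute {σ C : Matrix n n ℂ} (hσ : σ.PosSemidef) (h : C * σ = σ * C) :
    C * mlog σ = mlog σ * C := by
  obtain ⟨W, b, hW, hb, e⟩ := exists_diag hσ
  have hW' := unit_comm hW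
  rw [mlog_of_diag hW b e]
  have h1 : (Wᴴ * C * W) * diagonal (fun i => (b i : ℂ)) =
      diagonal (fun i => (b i : ℂ)) * (Wᴴ * C * W) := by
    calc _ = Wᴴ * (C * (W * diagonal (fun i => (b i : ℂ)) * Wᴴ)) * W := by
          simp only [Matrix.mul_assoc]; rw [hW', Matrix.mul_one]
      _ = Wᴴ * ((W * diagonal (fun i => (b i : ℂ)) * Wᴴ) * C) * W := by rw [← e, h]
      _ = (Wᴴ * W) * diagonal (fun i => (b i : ℂ)) * (Wᴴ * C * W) := by
          simp only [Matrix.mul_assoc]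
      _ = _ := by rw [hW', Matrix.one_mul]
  have h2 : (Wᴴ * C * W) * diagonal (fun i => (Real.log (b i) : ℂ)) =
      diagonal (fun i => (Real.log (b i) : ℂ)) * (Wᴴ * C * W) := by
    ext i j
    have := congrFun (congrFun h1 i) j
    rw [mul_diagonal, diagonal_mul] at this ⊢
    by_cases h0 : (Wᴴ * C * W) i j = 0
    · simp [h0]
    · rw [mul_comm] at this
      have h2 := mul_right_cancel₀ h0 this
      have h3 : b j = b i := by exact_mod_cast h2
      rw [h3, mul_comm]
  calc C * (W * diagonal (fun i => (Real.log (b i) : ℂ)) * Wᴴ)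
      = (W * Wᴴ) * (C * (W * diagonal (fun i => (Real.log (b i) : ℂ)) * Wᴴ)) := by
        rw [hW, Matrix.one_mul]
    _ = W * ((Wᴴ * C * W) * diagonal (fun i => (Real.log (b i) : ℂ))) * Wᴴ := by
        simp only [Matrix.mul_assoc]
    _ = W * diagonal (fun i => (Real.log (b i) : ℂ)) * Wᴴ * C * (W * Wᴴ) := by
        rw [h2]; simp only [Matrix.mul_assoc]
    _ = _ := by rw [hW, Matrix.mul_one]

/-- pinching -/
def pin (P : ι → Matrix n n ℂ) (τ : Matrix n n ℂ) : Matrix n n ℂ := ∑ l, P l * τ * P l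

variable {P : ι → Matrix n n ℂ} {τ : Matrix n n ℂ}

lemma pin_psd (hP : ∀ l, (P l)ᴴ = P l) (hτ : τ.PosSemidef) : (pin P τ).PosSemidef := by
  unfold pin
  refine posSemidef_sum _ fun l _ => ?_
  have := hτ.mul_mul_conjTranspose_same (P l)
  rwa [hP] at this

lemma pin_ker (hP : ∀ l, (P l)ᴴ = P l) (hs : ∑ l, P l = 1) (hτ : τ.PosSemidef) (v : n → ℂ)
    (hv : pin P τ *ᵥ v = 0) : τ *ᵥ v = 0 := by
  have h1 : ∑ l, star (P l *ᵥ v) ⬝ᵥ (τ *ᵥ (P l *ᵥ v)) = 0 := by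
    have : star v ⬝ᵥ (pin P τ *ᵥ v) = 0 := by rw [hv, dotProduct_zero]
    unfold pin at this
    rw [sum_mulVec, dotProduct_sum] at this
    rw [← this]
    refine Finset.sum_congr rfl fun l _ => ?_
    rw [star_mulVec, hP, ← dotProduct_mulVec, mulVec_mulVec, mulVec_mulVec, Matrix.mul_assoc]
  rw [Finset.sum_eq_zero_iff_of_nonneg (fun l _ => hτ.dotProduct_mulVec_nonneg _)] at h1
  have h2 : τ *ᵥ v = ∑ l, τ *ᵥ (P l *ᵥ v) := by
    conv_lhs => rw [← one_mulVec v, ← hs, sum_mulVec, mulVec_sum]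
  rw [h2]
  refine Finset.sum_eq_zero fun l hl => ?_
  exact (hτ.dotProduct_mulVec_zero_iff _).mp (h1 l hl)

lemma pin_comm (ho : ∀ l m, P l * P m = if l = m then P l else 0) (l : ι) :
    P l * pin P τ = pin P τ * P l := by
  unfold pin
  rw [Finset.mul_sum, Finset.sum_mul]
  refine Finset.sum_congr rfl fun m _ => ?_
  rw [Matrix.mul_assoc _ _ (P l), ho, ← Matrix.mul_assoc, ← Matrix.mul_assoc, ho]
  by_cases h : l = m
  · subst h; simp
  · rw [if_neg h, if_neg (Ne.symm h)]; simp

lemma relent_pin (hP : ∀ l, (P l)ᴴ = P l) (hs : ∑ l, P l = 1)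
    (ho : ∀ l m, P l * P m = if l = m then P l else 0) (hτ : τ.PosSemidef) :
    relent τ (pin P τ) = vN (pin P τ) - vN τ := by
  have hc := fun l => mlog_commute (pin_psd hP hτ) (pin_comm (τ := τ) ho l)
  unfold relent vN
  have : trace (pin P τ * mlog (pin P τ)) = trace (τ * mlog (pin P τ)) := by
    generalize mlog (pin P τ) = L at hc
    unfold pin
    rw [Finset.sum_mul, trace_sum]
    calc _ = ∑ l, trace (τ * (P l * L)) := by
          refine Finset.sum_congr rfl fun l _ => ?_
          rw [Matrix.mul_assoc, Matrix.mul_assoc, trace_mul_comm, hc, Matrix.mul_assoc,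
            Matrix.mul_assoc, ho, if_pos rfl]
      _ = _ := by rw [← trace_sum, ← Finset.mul_sum, ← Finset.sum_mul, hs, Matrix.one_mul]
  rw [Matrix.mul_sub, trace_sub, Complex.sub_re, this]
  ring

end Pinch

lemma proj_herm {α : Type*} (v : α → ℂ) : (proj v)ᴴ = proj v := by
  ext i j
  simp [proj, vecMulVec_apply, mul_comm]

lemma proj_mul {α : Type*} [Fintype α] [DecidableEq α] {g : α → α → ℂ}
    (hg : ∀ l m, star (g l) ⬝ᵥ g m = if l = m then 1 else 0) (l m : α) :
    proj (g l) * proj (g m) = if l = m then proj (g l) else 0 := by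
  unfold proj
  rw [vecMulVec_mul_vecMulVec, hg]
  by_cases h : l = m
  · subst h; simp
  · simp [h]

lemma proj_trace {α : Type*} [Fintype α] [DecidableEq α] {g : α → α → ℂ}
    (hg : ∀ l m, star (g l) ⬝ᵥ g m = if l = m then 1 else 0) (l : α) :
    trace (proj (g l)) = 1 := by
  unfold proj
  rw [trace_vecMulVec, dotProduct_comm, hg, if_pos rfl]

lemma phase_mul (x r : ℝ) :
    Complex.exp (-(Complex.I) * x * r) * star (Complex.exp (-(Complex.I) * x * r)) = 1 := by
  rw [Complex.star_def, ← Complex.exp_conj, ← Complex.exp_add]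
  simp

lemma proj_Urot {α : Type*} [Fintype α] [DecidableEq α] {g : α → α → ℂ}
    (hg : ∀ l m, star (g l) ⬝ᵥ g m = if l = m then 1 else 0) (gv : α → ℝ) (r : ℝ) (l : α) :
    proj (g l) * Urot g gv r = Complex.exp (-(Complex.I) * (gv l) * r) • proj (g l) := by
  unfold Urot
  rw [Finset.mul_sum, Finset.sum_eq_single l]
  · rw [mul_smul_comm, proj_mul hg, if_pos rfl]
  · intro m _ hm
    rw [mul_smul_comm, proj_mul hg, if_neg (Ne.symm hm), smul_zero]
  · simp

lemma Urot_unit {α : Type*} [Fintype α] [DecidableEq α] {g : α → α → ℂ}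
    (hg : ∀ l m, star (g l) ⬝ᵥ g m = if l = m then 1 else 0)
    (hgc : ∑ l, proj (g l) = (1 : Matrix α α ℂ)) (gv : α → ℝ) (r : ℝ) :
    Urot g gv r * (Urot g gv r)ᴴ = 1 := by
  have h1 : ∀ l, proj (g l) * (Urot g gv r * (Urot g gv r)ᴴ) = proj (g l) := by
    intro l
    have h2 : proj (g l) * (Urot g gv r)ᴴ =
        star (Complex.exp (-(Complex.I) * (gv l) * r)) • proj (g l) := by
      unfold Urot
      rw [conjTranspose_sum, Finset.mul_sum, Finset.sum_eq_single l]
      · rw [conjTranspose_smul, proj_herm, mul_smul_comm, proj_mul hg, if_pos rfl]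
      · intro m _ hm
        rw [conjTranspose_smul, proj_herm, mul_smul_comm, proj_mul hg, if_neg (Ne.symm hm),
          smul_zero]
      · simp
    rw [← Matrix.mul_assoc, proj_Urot hg, smul_mul_assoc, h2, smul_smul, phase_mul, one_smul]
  calc _ = (∑ l, proj (g l)) * (Urot g gv r * (Urot g gv r)ᴴ) := by rw [hgc, Matrix.one_mul]
    _ = 1 := by rw [Finset.sum_mul]; simp only [h1]; exact hgc

section K
variable {iR iA iB : Type*} [Fintype iR] [Fintype iA] [Fintype iB]
  [DecidableEq iR] [DecidableEq iA] [DecidableEq iB]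

/-- the averaged state on AB -/
def tauAB (p : iR → ℝ) (N : iR → Matrix iA iA ℂ) (ρ : Matrix iA iA ℂ) : Matrix iA iA ℂ :=
  ∑ k, (p k : ℂ) • (N k * ρ * (N k)ᴴ)

lemma tau_psd {p : iR → ℝ} (hp : ∀ k, 0 ≤ p k) (N : iR → Matrix iA iA ℂ) {ρ : Matrix iA iA ℂ}
    (hρ : ρ.PosSemidef) : (tauAB p N ρ).PosSemidef := by
  unfold tauAB
  refine posSemidef_sum _ fun k _ => ?_
  refine PosSemidef.smul (hρ.mul_mul_conjTranspose_same _) ?_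
  exact_mod_cast hp k

lemma redA2_psd {ρ : Matrix (iA × iB) (iA × iB) ℂ} (hρ : ρ.PosSemidef) : (redA2 ρ).PosSemidef := by
  have : redA2 ρ = ∑ b : iB, ρ.submatrix (fun a => (a, b)) (fun a => (a, b)) := by
    ext i j
    simp [redA2, Matrix.sum_apply]
  rw [this]
  exact posSemidef_sum _ fun b _ => hρ.submatrix _

lemma redA2_sandwich (M N : Matrix iA iA ℂ) (ρ : Matrix (iA × iB) (iA × iB) ℂ) :
    redA2 ((M ⊗ₖ (1 : Matrix iB iB ℂ)) * ρ * (N ⊗ₖ (1 : Matrix iB iB ℂ))) = M * redA2 ρ * N := by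
  ext i j
  simp only [redA2, of_apply, mul_apply, Fintype.sum_prod_type, kroneckerMap_apply,
    one_apply, mul_ite, mul_one, mul_zero, ite_mul, zero_mul, Finset.sum_ite_eq,
    Finset.sum_ite_eq', Finset.mem_univ, if_true, Finset.mul_sum, Finset.sum_mul]
  rw [Finset.sum_comm]
  refine Finset.sum_congr rfl fun x _ => ?_
  rw [Finset.sum_comm]

lemma redA2_sum {ι : Type*} (s : Finset ι) (f : ι → Matrix (iA × iB) (iA × iB) ℂ) :
    redA2 (∑ l ∈ s, f l) = ∑ l ∈ s, redA2 (f l) := by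
  ext i j
  simp only [redA2, of_apply, Matrix.sum_apply]
  rw [Finset.sum_comm]

lemma redB_trace (σ : Matrix (iA × iB) (iA × iB) ℂ) (i j : iB) :
    redB2' σ i j = trace (σ * ((1 : Matrix iA iA ℂ) ⊗ₖ (Matrix.single j i (1:ℂ)))) := by
  simp only [redB2', of_apply, trace, diag_apply, mul_apply, Fintype.sum_prod_type,
    kroneckerMap_apply, one_apply, single_apply]
  refine Finset.sum_congr rfl fun a _ => ?_
  rw [Finset.sum_eq_single i, Finset.sum_eq_single a, Finset.sum_eq_single j]
  · simp
  · intro b _ hb; simp [hb.symm]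
  · simp
  · intro b _ hb; simp [hb]
  · simp
  · intro b _ hb; simp [hb.symm]
  · simp

lemma redB_pin {g : iA → iA → ℂ}
    (hg : ∀ l m, star (g l) ⬝ᵥ g m = if l = m then 1 else 0)
    (hgc : ∑ l, proj (g l) = (1 : Matrix iA iA ℂ)) (ρ : Matrix (iA × iB) (iA × iB) ℂ) :
    redB2' (omega2 g ρ) = redB2' ρ := by
  ext i j
  rw [redB_trace, redB_trace]
  unfold omega2
  rw [Finset.sum_mul, trace_sum]
  calc _ = ∑ l, trace (ρ * (proj (g l) ⊗ₖ (Matrix.single j i (1:ℂ)))) := by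
        refine Finset.sum_congr rfl fun l _ => ?_
        rw [Matrix.mul_assoc, Matrix.mul_assoc, trace_mul_comm, Matrix.mul_assoc,
          ← mul_kronecker_mul, ← mul_kronecker_mul, Matrix.mul_one, proj_mul hg, if_pos rfl,
          Matrix.one_mul, Matrix.mul_one]
    _ = _ := by
      rw [← trace_sum, ← Finset.mul_sum]
      congr 2
      rw [← hgc]
      ext x y
      simp [Matrix.sum_apply, kroneckerMap_apply, Finset.sum_mul]

/-- abstract classical-quantum state -/
def kap (p : iR → ℝ) (rb : iR → iR → ℂ) (N : iR → Matrix iA iA ℂ) (ρ : Matrix iA iA ℂ) :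
    Matrix (iR × iA) (iR × iA) ℂ :=
  ∑ k, (p k : ℂ) • (proj (rb k) ⊗ₖ (N k * ρ * (N k)ᴴ))

lemma vN_kap {p : iR → ℝ} (hps : ∑ k, p k = 1) {rb : iR → iR → ℂ}
    (hrbc : ∑ k, proj (rb k) = (1 : Matrix iR iR ℂ))
    {N : iR → Matrix iA iA ℂ} (hN : ∀ k, N k * (N k)ᴴ = 1) {ρ : Matrix iA iA ℂ}
    (hρ : ρ.PosSemidef) (htr : trace ρ = 1) :
    vN (kap p rb N ρ) = - ∑ k, p k * Real.log (p k) + vN ρ := by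
  obtain ⟨U, d, hU, hd, e⟩ := exists_diag hρ
  let V : Matrix (iR × iA) (iR × iA) ℂ := Matrix.of fun x y => rb y.1 x.1 * (N y.1 * U) x.2 y.2
  have hNU : ∀ k, (N k * U) * (N k * U)ᴴ = 1 := by
    intro k
    rw [conjTranspose_mul]
    calc _ = N k * (U * Uᴴ) * (N k)ᴴ := by simp only [Matrix.mul_assoc]
      _ = 1 := by rw [hU, Matrix.mul_one, hN]
  have hgen : ∀ (f : iR → ℂ) (h : iA → ℂ), V * diagonal (fun x : iR × iA => f x.1 * h x.2) * Vᴴ =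
      ∑ k, f k • (proj (rb k) ⊗ₖ ((N k * U) * diagonal h * (N k * U)ᴴ)) := by
    intro f h
    ext ⟨r, x⟩ ⟨s, y⟩
    rw [mul_apply, Fintype.sum_prod_type, Matrix.sum_apply]
    refine Finset.sum_congr rfl fun k _ => ?_
    rw [Matrix.smul_apply, kroneckerMap_apply, mul_apply, Finset.mul_sum, smul_eq_mul, Finset.mul_sum]
    refine Finset.sum_congr rfl fun i _ => ?_
    rw [mul_diagonal, mul_diagonal, conjTranspose_apply, conjTranspose_apply]
    simp only [V, of_apply, proj, vecMulVec_apply, star_mul', Pi.star_apply]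
    ring
  have hV : V * Vᴴ = 1 := by
    have := hgen (fun _ => 1) (fun _ => 1)
    simp only [mul_one, diagonal_one, Matrix.mul_one, hNU, one_smul] at this
    rw [this]
    have h2 : ∑ k, proj (rb k) ⊗ₖ (1 : Matrix iA iA ℂ) =
        (∑ k, proj (rb k)) ⊗ₖ (1 : Matrix iA iA ℂ) := by
      ext x y
      simp [Matrix.sum_apply, kroneckerMap_apply, Finset.sum_mul]
    rw [h2, hrbc, one_kronecker_one]
  have hK : kap p rb N ρ = V * diagonal (fun x : iR × iA => ((p x.1 * d x.2 : ℝ) : ℂ)) * Vᴴ := by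
    have := hgen (fun k => (p k : ℂ)) (fun i => (d i : ℂ))
    push_cast
    rw [this]
    unfold kap
    refine Finset.sum_congr rfl fun k _ => ?_
    congr 2
    rw [e, conjTranspose_mul]
    simp only [Matrix.mul_assoc]
  have hds : ∑ i, d i = 1 := by
    rw [e, tr_conj hU] at htr
    exact_mod_cast htr
  rw [vN_of_diag hV _ hK, vN_of_diag hU d e, Fintype.sum_prod_type]
  have : ∀ k i, p k * d i * Real.log (p k * d i) =
      (p k * Real.log (p k)) * d i + p k * (d i * Real.log (d i)) := by
    intro k i
    by_cases h1 : p k = 0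
    · simp [h1]
    by_cases h2 : d i = 0
    · simp [h2]
    rw [Real.log_mul h1 h2]
    ring
  simp only [this, Finset.sum_add_distrib, ← Finset.mul_sum, hds, mul_one]
  rw [← Finset.sum_mul, hps]
  ring

lemma vN_classical {p : iR → ℝ} {rb : iR → iR → ℂ}
    (hrbc : ∑ k, proj (rb k) = (1 : Matrix iR iR ℂ)) :
    vN (∑ k, (p k : ℂ) • proj (rb k)) = - ∑ k, p k * Real.log (p k) := by
  let V : Matrix iR iR ℂ := Matrix.of fun r k => rb k r
  have hgen : ∀ f : iR → ℂ, V * diagonal f * Vᴴ = ∑ k, f k • proj (rb k) := by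
    intro f
    ext r s
    rw [mul_apply, Matrix.sum_apply]
    refine Finset.sum_congr rfl fun k _ => ?_
    rw [mul_diagonal, conjTranspose_apply, Matrix.smul_apply]
    simp only [V, of_apply, proj, vecMulVec_apply, Pi.star_apply, smul_eq_mul]
    ring
  have hV : V * Vᴴ = 1 := by
    have := hgen (fun _ => 1)
    simpa [hrbc] using this
  exact vN_of_diag hV p (hgen _).symm

end K

lemma kronL_sum {ι α β : Type*} [Fintype ι] (f : ι → Matrix α α ℂ) (M : Matrix β β ℂ) :
    (∑ k, f k) ⊗ₖ M = ∑ k, f k ⊗ₖ M := by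
  ext x y
  simp [Matrix.sum_apply, kroneckerMap_apply, Finset.sum_mul]

/-- **Bipartite entropic time-energy uncertainty relation** (Theorem 2):
`S(R|AB)_κ + S(A|B)_ω ≥ S(R)_κ + D(κ_A‖ω_A) + S(A|B)_ρ`. -/
theorem bipartite_entropic_uncertainty
    {iR iA iB : Type*} [Fintype iR] [Fintype iA] [Fintype iB]
    [DecidableEq iR] [DecidableEq iA] [DecidableEq iB]
    (ρ : Matrix (iA × iB) (iA × iB) ℂ)
    (hρ : ρ.PosSemidef) (hρtr : ρ.trace = 1)
    (g : iA → iA → ℂ) (gv : iA → ℝ)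
    (hg : ∀ l m, star (g l) ⬝ᵥ g m = if l = m then 1 else 0)
    (hgc : ∑ l, proj (g l) = (1 : Matrix iA iA ℂ))
    (rb : iR → iR → ℂ)
    (hrb : ∀ k m, star (rb k) ⬝ᵥ rb m = if k = m then 1 else 0)
    (hrbc : ∑ k, proj (rb k) = (1 : Matrix iR iR ℂ))
    (rv : iR → ℝ) (p : iR → ℝ) (hp : ∀ k, 0 ≤ p k) (hps : ∑ k, p k = 1) :
    (vN (kappa2 p rb rv g gv ρ) - vN (redABthree (kappa2 p rb rv g gv ρ)))
      + (vN (omega2 g ρ) - vN (redB2' (omega2 g ρ)))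
    ≥ vN (redRthree (kappa2 p rb rv g gv ρ))
      + relent (redAthree (kappa2 p rb rv g gv ρ)) (redA2 (omega2 g ρ))
      + (vN ρ - vN (redB2' ρ)) := by
  have hU1 : ∀ k, (Urot g gv (rv k) ⊗ₖ (1 : Matrix iB iB ℂ)) *
      (Urot g gv (rv k) ⊗ₖ (1 : Matrix iB iB ℂ))ᴴ = 1 := by
    intro k
    rw [conjTranspose_kronecker, conjTranspose_one, ← mul_kronecker_mul, Urot_unit hg hgc,
      Matrix.one_mul, one_kronecker_one]
  have hPh : ∀ l, (proj (g l) ⊗ₖ (1 : Matrix iB iB ℂ))ᴴ = proj (g l) ⊗ₖ (1 : Matrix iB iB ℂ) := by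
    intro l
    rw [conjTranspose_kronecker, conjTranspose_one, proj_herm]
  have hPs : ∑ l, (proj (g l) ⊗ₖ (1 : Matrix iB iB ℂ)) = 1 := by
    rw [← kronL_sum, hgc, one_kronecker_one]
  have hPo : ∀ l m, (proj (g l) ⊗ₖ (1 : Matrix iB iB ℂ)) * (proj (g m) ⊗ₖ (1 : Matrix iB iB ℂ)) =
      if l = m then (proj (g l) ⊗ₖ (1 : Matrix iB iB ℂ)) else 0 := by
    intro l m
    rw [← mul_kronecker_mul, proj_mul hg, Matrix.one_mul]
    split_ifs
    · rfl
    · exact zero_kronecker _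
  set τ := tauAB p (fun k => Urot g gv (rv k) ⊗ₖ (1 : Matrix iB iB ℂ)) ρ with hτdef
  have hτ : τ.PosSemidef := tau_psd hp _ hρ
  -- reductions of kappa
  have hAB : redABthree (kappa2 p rb rv g gv ρ) = τ := by
    ext x y
    simp only [redABthree, kappa2, of_apply, hτdef, tauAB, Matrix.sum_apply, Matrix.smul_apply,
      kroneckerMap_apply, smul_eq_mul]
    rw [Finset.sum_comm]
    refine Finset.sum_congr rfl fun k _ => ?_
    rw [← Finset.mul_sum, ← Finset.sum_mul]
    have := proj_trace hrb k
    simp only [trace, diag_apply] at this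
    rw [this, one_mul]
  have hA : redAthree (kappa2 p rb rv g gv ρ) = redA2 τ := by
    rw [← hAB]
    ext i j
    simp only [redAthree, redA2, redABthree, of_apply]
    rw [Finset.sum_comm]
  have hR : redRthree (kappa2 p rb rv g gv ρ) = ∑ k, (p k : ℂ) • proj (rb k) := by
    ext i j
    simp only [redRthree, kappa2, of_apply, Matrix.sum_apply, Matrix.smul_apply,
      kroneckerMap_apply, smul_eq_mul]
    rw [Finset.sum_comm]
    refine Finset.sum_congr rfl fun k _ => ?_
    rw [← Finset.mul_sum, ← Finset.mul_sum]
    have : trace ((Urot g gv (rv k) ⊗ₖ (1 : Matrix iB iB ℂ)) * ρ *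
        (Urot g gv (rv k) ⊗ₖ (1 : Matrix iB iB ℂ))ᴴ) = 1 := by
      rw [trace_mul_comm, ← Matrix.mul_assoc, unit_comm (hU1 k), Matrix.one_mul, hρtr]
    simp only [trace, diag_apply] at this
    rw [this, mul_one]
  have hω : omega2 g ρ = pin (fun l => proj (g l) ⊗ₖ (1 : Matrix iB iB ℂ)) τ := by
    unfold omega2 pin
    refine Finset.sum_congr rfl fun l _ => ?_
    rw [hτdef]
    unfold tauAB
    rw [Finset.mul_sum, Finset.sum_mul]
    have hk : ∀ k, (proj (g l) ⊗ₖ (1 : Matrix iB iB ℂ)) * ((p k : ℂ) •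
        ((Urot g gv (rv k) ⊗ₖ (1 : Matrix iB iB ℂ)) * ρ *
        (Urot g gv (rv k) ⊗ₖ (1 : Matrix iB iB ℂ))ᴴ)) * (proj (g l) ⊗ₖ (1 : Matrix iB iB ℂ)) =
        (p k : ℂ) • ((proj (g l) ⊗ₖ (1 : Matrix iB iB ℂ)) * ρ *
          (proj (g l) ⊗ₖ (1 : Matrix iB iB ℂ))) := by
      intro k
      have h1 : (proj (g l) ⊗ₖ (1 : Matrix iB iB ℂ)) * (Urot g gv (rv k) ⊗ₖ (1 : Matrix iB iB ℂ)) =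
          Complex.exp (-(Complex.I) * (gv l) * (rv k)) • (proj (g l) ⊗ₖ (1 : Matrix iB iB ℂ)) := by
        rw [← mul_kronecker_mul, proj_Urot hg, Matrix.one_mul, smul_kronecker]
      have h2 : (Urot g gv (rv k) ⊗ₖ (1 : Matrix iB iB ℂ))ᴴ * (proj (g l) ⊗ₖ (1 : Matrix iB iB ℂ)) =
          star (Complex.exp (-(Complex.I) * (gv l) * (rv k))) •
            (proj (g l) ⊗ₖ (1 : Matrix iB iB ℂ)) := by
        have := congrArg conjTranspose h1
        rwa [conjTranspose_mul, conjTranspose_smul, hPh] at this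
      rw [mul_smul_comm, smul_mul_assoc]
      congr 1
      calc _ = ((proj (g l) ⊗ₖ (1 : Matrix iB iB ℂ)) * (Urot g gv (rv k) ⊗ₖ (1 : Matrix iB iB ℂ))) *
            ρ * ((Urot g gv (rv k) ⊗ₖ (1 : Matrix iB iB ℂ))ᴴ *
              (proj (g l) ⊗ₖ (1 : Matrix iB iB ℂ))) := by simp only [Matrix.mul_assoc]
        _ = _ := by
          rw [h1, h2, smul_mul_assoc, smul_mul_assoc, mul_smul_comm, smul_smul, phase_mul, one_smul]
    simp only [hk]
    rw [← Finset.sum_smul]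
    have : ∑ k, (p k : ℂ) = 1 := by exact_mod_cast hps
    rw [this, one_smul]
  have hωA : redA2 (omega2 g ρ) = pin (fun l => proj (g l)) (redA2 τ) := by
    rw [hω]
    unfold pin
    rw [redA2_sum]
    exact Finset.sum_congr rfl fun l _ => redA2_sandwich _ _ _
  have hτA := redA2_psd hτ
  have hvk : vN (kappa2 p rb rv g gv ρ) = - ∑ k, p k * Real.log (p k) + vN ρ :=
    vN_kap hps hrbc hU1 hρ hρtr
  have hrel := relent_pin hPh hPs hPo hτ
  have hωP : (omega2 g ρ).PosSemidef := hω ▸ pin_psd hPh hτ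
  have hωAP : (redA2 (omega2 g ρ)).PosSemidef := redA2_psd hωP
  have hmono := relent_mono hτ hωP hτA hωAP
    (fun v hv => pin_ker hPh hPs hτ v (hω ▸ hv))
    (fun v hv => pin_ker (fun l => proj_herm (g l)) hgc hτA v (hωA ▸ hv))
  rw [← hω] at hrel
  rw [hvk, hAB, hA, hR, vN_classical hrbc, redB_pin hg hgc]
  linarith
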